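/- arXiv:2603.28598 — 3 statements merged into one kernel-verified Lean document; each statement's English description precedes it below -/
import Mathlib

section
/- For every real number x ∈ [0,1] there exists a digit sequence α = (α_n)_{n≥1} with α_n ∈ {0,…,s−1} such that x = Δ(α). In other words, the map Δ from digit sequences to [0,1] is surjective. -/
open Filter Topology MeasureTheory Set

set_option linter.unusedVariables false

/-- β_{k,n} = Σ_{i<k} q_{i,n}. -/
noncomputable def qbeta (s : ℕ) (q : Fin s → ℕ → ℝ) (k : Fin s) (n : ℕ) : ℝ :=
  ∑ i : Fin s, if i < k then q i n else 0

/-- Δ(α) = β_{α_1,1} + Σ_{n≥2} β_{α_n,n} Π_{j<n} q_{α_j,j}, with positions indexed from 0. -/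
noncomputable def Delta (s : ℕ) (q : Fin s → ℕ → ℝ) (α : ℕ → Fin s) : ℝ :=
  ∑' n : ℕ, qbeta s q (α n) n * ∏ j ∈ Finset.range n, q (α j) j

/-- the digit |a − b|. -/
def adiff {s : ℕ} (a b : Fin s) : Fin s :=
  ⟨a.1 - b.1 + (b.1 - a.1), by have ha := a.2; have hb := b.2; omega⟩

theorem qbeta_nonneg {s : ℕ} {q : Fin s → ℕ → ℝ} (hq0 : ∀ i n, 0 < q i n) (k : Fin s) (n : ℕ) :
    0 ≤ qbeta s q k n :=
  Finset.sum_nonneg fun i _ => by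
    split_ifs
    exacts [(hq0 i n).le, le_rfl]

theorem qbeta_add_self {s : ℕ} (q : Fin s → ℕ → ℝ) (k : Fin s) (n : ℕ) :
    qbeta s q k n + q k n = ∑ i : Fin s, if i ≤ k then q i n else 0 := by
  have h : q k n = ∑ i : Fin s, if i = k then q i n else 0 := by simp
  rw [h, qbeta, ← Finset.sum_add_distrib]
  refine Finset.sum_congr rfl fun i _ => ?_
  rcases lt_trichotomy i k with h | h | h
  · simp [h, h.le, h.ne]
  · simp [h]
  · simp [h.not_gt, h.not_ge, h.ne']

/-- The intervals `[β_k, β_k + q_k]` cover `[0,1]`. -/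
theorem exists_digit {s : ℕ} (hs : 0 < s) {q : Fin s → ℕ → ℝ} {n : ℕ}
    (hqsum : ∑ i : Fin s, q i n = 1) {y : ℝ} (hy : y ∈ Icc (0 : ℝ) 1) :
    ∃ k : Fin s, qbeta s q k n ≤ y ∧ y ≤ qbeta s q k n + q k n := by
  obtain ⟨k, hk, hmax⟩ := (Set.toFinite {k : Fin s | qbeta s q k n ≤ y}).exists_maximal
    ⟨⟨0, hs⟩, by simpa only [Set.mem_ofPred_eq, qbeta, Fin.lt_def, Nat.not_lt_zero, if_false,
      Finset.sum_const_zero] using hy.1⟩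
  refine ⟨k, hk, ?_⟩
  by_cases hlast : k.1 + 1 < s
  · by_contra! hlt
    have hsucc : qbeta s q ⟨k.1 + 1, hlast⟩ n = qbeta s q k n + q k n := by
      rw [qbeta_add_self]
      simp only [qbeta, Fin.lt_def, Fin.le_def, Nat.lt_succ_iff]
    have hle := hmax (y := ⟨k.1 + 1, hlast⟩) (by simpa [hsucc] using hlt.le)
      (by simp [Fin.le_def])
    simp [Fin.le_def] at hle
  · have htop : ∀ i : Fin s, i ≤ k := fun i => by
      rw [Fin.le_def]
      omega
    simpa [qbeta_add_self, htop, hqsum] using hy.2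

/-- every x ∈ [0,1] has a Q*_s-representation, i.e. Δ is onto [0,1]. -/
theorem stmt0 (s : ℕ) (hs : 2 ≤ s) (q : Fin s → ℕ → ℝ)
    (hq0 : ∀ i n, 0 < q i n) (hq1 : ∀ i n, q i n < 1)
    (hqsum : ∀ n, ∑ i : Fin s, q i n = 1)
    (hqprod : Filter.Tendsto (fun N => ∏ n ∈ Finset.range N, ⨆ i : Fin s, q i n)
      Filter.atTop (nhds 0)) :
    ∀ x ∈ Set.Icc (0 : ℝ) 1, ∃ α : ℕ → Fin s, x = Delta s q α := by
  intro x hx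
  have : Nonempty (Fin s) := ⟨⟨0, by omega⟩⟩
  choose! d hd using fun n (y : ℝ) (hy : y ∈ Icc (0 : ℝ) 1) =>
    exists_digit (by omega : 0 < s) (hqsum n) hy
  let r : ℕ → ℝ := fun n => Nat.rec x (fun n y => (y - qbeta s q (d n y) n) / q (d n y) n) n
  let α : ℕ → Fin s := fun n => d n (r n)
  have hr_succ : ∀ n, r (n + 1) = (r n - qbeta s q (α n) n) / q (α n) n := fun n => rfl
  have hr : ∀ n, r n ∈ Icc (0 : ℝ) 1 := by
    intro n
    induction n with
    | zero => exact hx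
    | succ n ih =>
      obtain ⟨h1, h2⟩ := hd n (r n) ih
      rw [hr_succ]
      exact ⟨div_nonneg (sub_nonneg.2 h1) (hq0 _ _).le,
        (div_le_one (hq0 _ _)).2 (sub_le_iff_le_add'.2 h2)⟩
  have hP : ∀ N, 0 ≤ ∏ j ∈ Finset.range N, q (α j) j := fun N =>
    Finset.prod_nonneg fun j _ => (hq0 _ _).le
  have hsum : ∀ N, ∑ n ∈ Finset.range N, qbeta s q (α n) n * ∏ j ∈ Finset.range n, q (α j) j
      = x - r N * ∏ j ∈ Finset.range N, q (α j) j := by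
    intro N
    induction N with
    | zero => simp [r]
    | succ N ih =>
      have hne := (hq0 (α N) N).ne'
      rw [Finset.sum_range_succ, ih, Finset.prod_range_succ, hr_succ]
      field_simp
      ring
  have hrem : Tendsto (fun N => r N * ∏ j ∈ Finset.range N, q (α j) j) atTop (𝓝 0) := by
    refine squeeze_zero (fun N => mul_nonneg (hr N).1 (hP N)) (fun N => ?_) hqprod
    exact (mul_le_of_le_one_left (hP N) (hr N).2).trans
      (Finset.prod_le_prod (fun j _ => (hq0 _ _).le) fun j _ =>
        le_ciSup (f := fun i => q i j) (Set.finite_range _).bddAbove (α j))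
  refine ⟨α, (HasSum.tsum_eq ?_).symm⟩
  rw [hasSum_iff_tendsto_nat_of_nonneg fun n => mul_nonneg (qbeta_nonneg hq0 _ _) (hP n)]
  simpa only [hsum, sub_zero] using hrem.const_sub x
end

section
/- The digit inversor I : [0,1] → [0,1], defined by I(x) = Δ((s−1−α_n(x))_{n≥1}) where α(x) is the canonical digit sequence of x, satisfies I(Δ(α)) = Δ((s−1−α_n)_{n≥1}) for every digit sequence α (so I is well defined independently of the choice of representation), and I is continuous and strictly decreasing on [0,1]. -/
open Filter Topology MeasureTheory Set

set_option linter.unusedVariables false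

namespace QStar

theorem eq_limit_iff_of_monotone {u : ℕ → ℝ} {a : ℝ} (hu : Monotone u)
    (ha : Tendsto u atTop (𝓝 a)) (N : ℕ) : u N = a ↔ ∀ m ≥ N, u m = u (m + 1) := by
  constructor
  · intro h m hm
    have h1 := hu hm
    have h2 := hu (Nat.le_succ m)
    have h3 := hu.ge_of_tendsto ha (m + 1)
    simp only [Nat.succ_eq_add_one] at h2
    linarith
  · intro h
    have hc : ∀ m ≥ N, u m = u N := fun m hm => by
      induction m, hm using Nat.le_induction with
      | base => rfl
      | succ m hm ih => rw [← h m hm, ih]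
    refine tendsto_nhds_unique ?_ ha
    exact tendsto_const_nhds.congr' ((eventually_ge_atTop N).mono fun m hm => (hc m hm).symm)

/-- The sum of the weights `q i n` over the first `k` digits `i`. -/
noncomputable def cumul {s : ℕ} (q : Fin s → ℕ → ℝ) (n k : ℕ) : ℝ :=
  ∑ i : Fin s with i.val < k, q i n

/-- The length of the cylinder of rank `N` of a digit sequence. -/
noncomputable def length {s : ℕ} (q : Fin s → ℕ → ℝ) (α : ℕ → Fin s) (N : ℕ) : ℝ :=
  ∏ j ∈ Finset.range N, q (α j) j

/-- The left endpoint of the cylinder of rank `N` of a digit sequence. -/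
noncomputable def left {s : ℕ} (q : Fin s → ℕ → ℝ) (α : ℕ → Fin s) (N : ℕ) : ℝ :=
  ∑ n ∈ Finset.range N, qbeta s q (α n) n * ∏ j ∈ Finset.range n, q (α j) j

/-- The right endpoint of the cylinder of rank `N` of a digit sequence. -/
noncomputable def right {s : ℕ} (q : Fin s → ℕ → ℝ) (α : ℕ → Fin s) (N : ℕ) : ℝ :=
  left q α N + length q α N

variable {s : ℕ} {q : Fin s → ℕ → ℝ}

theorem qbeta_eq_cumul (k : Fin s) (n : ℕ) : qbeta s q k n = cumul q n k := by
  simp [qbeta, cumul, Finset.sum_filter]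

theorem cumul_zero (n : ℕ) : cumul q n 0 = 0 := by simp [cumul]

theorem cumul_size (hqsum : ∀ n, ∑ i : Fin s, q i n = 1) (n : ℕ) : cumul q n s = 1 := by
  simp [cumul, hqsum]

theorem cumul_succ (k : Fin s) (n : ℕ) : cumul q n (k + 1) = cumul q n k + q k n := by
  have : (Finset.univ.filter fun i : Fin s => i.val < k.val + 1) =
      insert k (Finset.univ.filter fun i : Fin s => i.val < k.val) := by
    ext i
    simp [Fin.ext_iff]
    omega
  rw [cumul, this, Finset.sum_insert (by simp), add_comm]
  rfl

theorem cumul_strictMonoOn (hq0 : ∀ i n, 0 < q i n) (n : ℕ) :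
    StrictMonoOn (cumul q n) (Iic s) := by
  intro a _ b hb hab
  have hb : b ≤ s := hb
  refine Finset.sum_lt_sum_of_subset (i := ⟨a, by omega⟩) ?_ ?_ ?_ (hq0 _ _)
    fun j _ _ => (hq0 j n).le
  · intro i
    simp
    omega
  · simpa using hab
  · simp

theorem length_pos (hq0 : ∀ i n, 0 < q i n) (α : ℕ → Fin s) (N : ℕ) : 0 < length q α N :=
  Finset.prod_pos fun j _ => hq0 _ _

theorem length_succ (α : ℕ → Fin s) (N : ℕ) :
    length q α (N + 1) = length q α N * q (α N) N :=
  Finset.prod_range_succ _ _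

theorem left_succ (α : ℕ → Fin s) (N : ℕ) :
    left q α (N + 1) = left q α N + cumul q N (α N) * length q α N := by
  rw [left, Finset.sum_range_succ, qbeta_eq_cumul]
  rfl

theorem right_succ (α : ℕ → Fin s) (N : ℕ) :
    right q α (N + 1) = left q α N + cumul q N (α N + 1) * length q α N := by
  rw [right, left_succ, length_succ, cumul_succ]
  ring

theorem left_monotone (hq0 : ∀ i n, 0 < q i n) (α : ℕ → Fin s) : Monotone (left q α) := by
  refine monotone_nat_of_le_succ fun N => ?_
  rw [left_succ]
  have h1 := (cumul_strictMonoOn hq0 N).monotoneOn (mem_Iic.2 (Nat.zero_le s))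
    (mem_Iic.2 (α N).2.le) (Nat.zero_le _)
  rw [cumul_zero] at h1
  have := mul_nonneg h1 (length_pos hq0 α N).le
  linarith

theorem left_eq_succ_iff (hq0 : ∀ i n, 0 < q i n) (α : ℕ → Fin s) (N : ℕ) :
    left q α N = left q α (N + 1) ↔ (α N).val = 0 := by
  rw [left_succ, left_eq_add, mul_eq_zero, or_iff_left (length_pos hq0 α N).ne',
    ← cumul_zero (q := q) N]
  exact (cumul_strictMonoOn hq0 N).injOn.eq_iff (mem_Iic.2 (α N).2.le) (mem_Iic.2 (Nat.zero_le s))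

theorem right_antitone (hq0 : ∀ i n, 0 < q i n) (hqsum : ∀ n, ∑ i : Fin s, q i n = 1)
    (α : ℕ → Fin s) : Antitone (right q α) := by
  refine antitone_nat_of_succ_le fun N => ?_
  rw [right_succ, right]
  have h1 := (cumul_strictMonoOn hq0 N).monotoneOn (mem_Iic.2 (α N).2) (mem_Iic.2 le_rfl) (α N).2
  rw [cumul_size hqsum] at h1
  have := mul_le_mul_of_nonneg_right h1 (length_pos hq0 α N).le
  simp only [Nat.succ_eq_add_one] at this
  linarith

theorem right_eq_succ_iff (hq0 : ∀ i n, 0 < q i n) (hqsum : ∀ n, ∑ i : Fin s, q i n = 1)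
    (α : ℕ → Fin s) (N : ℕ) :
    right q α N = right q α (N + 1) ↔ (α N).val + 1 = s := by
  rw [right_succ, right, add_right_inj, right_eq_mul₀ (length_pos hq0 α N).ne',
    ← cumul_size hqsum N]
  exact (cumul_strictMonoOn hq0 N).injOn.eq_iff (mem_Iic.2 (α N).2) (mem_Iic.2 le_rfl)

theorem left_tendsto (hq0 : ∀ i n, 0 < q i n) (hqsum : ∀ n, ∑ i : Fin s, q i n = 1)
    (α : ℕ → Fin s) : Tendsto (left q α) atTop (𝓝 (Delta s q α)) := by
  have hnn : ∀ n, 0 ≤ qbeta s q (α n) n * ∏ j ∈ Finset.range n, q (α j) j := fun n => by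
    have h := left_monotone hq0 α (Nat.le_succ n)
    rw [Nat.succ_eq_add_one, left, left, Finset.sum_range_succ] at h
    linarith
  refine (summable_of_sum_range_le (c := 1) hnn fun N => ?_).hasSum.tendsto_sum_nat
  change left q α N ≤ 1
  have h1 := right_antitone hq0 hqsum α (Nat.zero_le N)
  have h2 := length_pos hq0 α N
  simp only [right, left, length, Finset.range_zero, Finset.sum_empty, Finset.prod_empty] at h1 h2 ⊢
  linarith

theorem length_tendsto (hq0 : ∀ i n, 0 < q i n)
    (hqprod : Tendsto (fun N => ∏ n ∈ Finset.range N, ⨆ i : Fin s, q i n) atTop (𝓝 0))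
    (α : ℕ → Fin s) : Tendsto (length q α) atTop (𝓝 0) :=
  squeeze_zero (fun N => (length_pos hq0 α N).le)
    (fun _ => Finset.prod_le_prod (fun j _ => (hq0 _ _).le)
      fun j _ => le_ciSup (f := fun i => q i j) (finite_range _).bddAbove (α j)) hqprod

theorem right_tendsto (hq0 : ∀ i n, 0 < q i n) (hqsum : ∀ n, ∑ i : Fin s, q i n = 1)
    (hqprod : Tendsto (fun N => ∏ n ∈ Finset.range N, ⨆ i : Fin s, q i n) atTop (𝓝 0))
    (α : ℕ → Fin s) : Tendsto (right q α) atTop (𝓝 (Delta s q α)) := by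
  simpa only [add_zero] using! (left_tendsto hq0 hqsum α).add (length_tendsto hq0 hqprod α)

theorem left_le_Delta (hq0 : ∀ i n, 0 < q i n) (hqsum : ∀ n, ∑ i : Fin s, q i n = 1)
    (α : ℕ → Fin s) (N : ℕ) : left q α N ≤ Delta s q α :=
  (left_monotone hq0 α).ge_of_tendsto (left_tendsto hq0 hqsum α) N

theorem left_eq_Delta_iff (hq0 : ∀ i n, 0 < q i n) (hqsum : ∀ n, ∑ i : Fin s, q i n = 1)
    (α : ℕ → Fin s) (N : ℕ) :
    left q α N = Delta s q α ↔ ∀ m ≥ N, (α m).val = 0 := by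
  rw [eq_limit_iff_of_monotone (left_monotone hq0 α) (left_tendsto hq0 hqsum α)]
  simp only [left_eq_succ_iff hq0]

theorem Delta_le_right (hq0 : ∀ i n, 0 < q i n) (hqsum : ∀ n, ∑ i : Fin s, q i n = 1)
    (hqprod : Tendsto (fun N => ∏ n ∈ Finset.range N, ⨆ i : Fin s, q i n) atTop (𝓝 0))
    (α : ℕ → Fin s) (N : ℕ) : Delta s q α ≤ right q α N :=
  (right_antitone hq0 hqsum α).le_of_tendsto (right_tendsto hq0 hqsum hqprod α) N

theorem right_eq_Delta_iff (hq0 : ∀ i n, 0 < q i n) (hqsum : ∀ n, ∑ i : Fin s, q i n = 1)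
    (hqprod : Tendsto (fun N => ∏ n ∈ Finset.range N, ⨆ i : Fin s, q i n) atTop (𝓝 0))
    (α : ℕ → Fin s) (N : ℕ) :
    right q α N = Delta s q α ↔ ∀ m ≥ N, (α m).val + 1 = s := by
  have := eq_limit_iff_of_monotone (right_antitone hq0 hqsum α).neg
    (right_tendsto hq0 hqsum hqprod α).neg N
  simpa only [Pi.neg_apply, neg_inj, right_eq_succ_iff hq0 hqsum] using this

theorem Delta_mem_Icc (hq0 : ∀ i n, 0 < q i n) (hqsum : ∀ n, ∑ i : Fin s, q i n = 1)
    (hqprod : Tendsto (fun N => ∏ n ∈ Finset.range N, ⨆ i : Fin s, q i n) atTop (𝓝 0))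
    (α : ℕ → Fin s) : Delta s q α ∈ Icc (0 : ℝ) 1 := by
  have h1 := left_le_Delta hq0 hqsum α 0
  have h2 := Delta_le_right hq0 hqsum hqprod α 0
  simp only [right, left, length, Finset.range_zero, Finset.sum_empty, Finset.prod_empty,
    zero_add] at h1 h2
  exact ⟨h1, h2⟩

theorem Delta_le_and_eq_iff_of_lex (hq0 : ∀ i n, 0 < q i n) (hqsum : ∀ n, ∑ i : Fin s, q i n = 1)
    (hqprod : Tendsto (fun N => ∏ n ∈ Finset.range N, ⨆ i : Fin s, q i n) atTop (𝓝 0))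
    {α β : ℕ → Fin s} {n : ℕ} (h : ∀ m < n, α m = β m)
    (hn : α n < β n) :
    Delta s q α ≤ Delta s q β ∧ (Delta s q α = Delta s q β ↔
      (α n).val + 1 = (β n).val ∧ ∀ m ≥ n + 1, (α m).val + 1 = s ∧ (β m).val = 0) := by
  have hlen : length q α n = length q β n :=
    Finset.prod_congr rfl fun j hj => by rw [h j (Finset.mem_range.1 hj)]
  have hleft : left q α n = left q β n := Finset.sum_congr rfl fun k hk => by
    have hk := Finset.mem_range.1 hk
    rw [h k hk]
    congr 1
    exact Finset.prod_congr rfl fun j hj => by rw [h j ((Finset.mem_range.1 hj).trans hk)]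
  have hpos := length_pos hq0 β n
  have hα : (α n).val + 1 ∈ Iic s := (α n).2
  have hβ : (β n).val ∈ Iic s := (β n).2.le
  have hc := (cumul_strictMonoOn hq0 n).monotoneOn hα hβ hn
  have hmid : right q α (n + 1) ≤ left q β (n + 1) := by
    rw [right_succ, left_succ, hlen, hleft]
    gcongr
  have hmid_eq : right q α (n + 1) = left q β (n + 1) ↔ (α n).val + 1 = (β n).val := by
    rw [right_succ, left_succ, hlen, hleft, add_right_inj, mul_left_inj' hpos.ne']
    exact (cumul_strictMonoOn hq0 n).injOn.eq_iff hα hβ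
  have h1 := Delta_le_right hq0 hqsum hqprod α (n + 1)
  have h2 := left_le_Delta hq0 hqsum β (n + 1)
  refine ⟨h1.trans (hmid.trans h2), ?_⟩
  rw [forall₂_and, ← hmid_eq, ← right_eq_Delta_iff hq0 hqsum hqprod,
    ← left_eq_Delta_iff hq0 hqsum]
  constructor
  · intro h
    refine ⟨?_, ?_, ?_⟩ <;> linarith
  · rintro ⟨h3, h4, h5⟩
    linarith

theorem Delta_rev_lt (hq0 : ∀ i n, 0 < q i n) (hqsum : ∀ n, ∑ i : Fin s, q i n = 1)
    (hqprod : Tendsto (fun N => ∏ n ∈ Finset.range N, ⨆ i : Fin s, q i n) atTop (𝓝 0))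
    {α β : ℕ → Fin s} (hlt : Delta s q α < Delta s q β) :
    Delta s q (fun n => (β n).rev) < Delta s q (fun n => (α n).rev) := by
  have hne : ∃ n, α n ≠ β n := by
    by_contra! h
    exact hlt.ne (congrArg _ (funext h))
  classical
  set n := Nat.find hne
  have hbefore : ∀ m < n, α m = β m := fun m hm => not_not.1 (Nat.find_min hne hm)
  rcases lt_or_gt_of_ne (Nat.find_spec hne) with hn | hn
  · obtain ⟨hle, heq⟩ := Delta_le_and_eq_iff_of_lex hq0 hqsum hqprod
      (α := fun n => (β n).rev) (β := fun n => (α n).rev) (n := n)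
      (fun m hm => by simp only [hbefore m hm]) (Fin.rev_lt_rev.2 hn)
    refine lt_of_le_of_ne hle fun he => hlt.ne ?_
    rw [(Delta_le_and_eq_iff_of_lex hq0 hqsum hqprod hbefore hn).2]
    obtain ⟨h1, h2⟩ := heq.1 he
    simp only [Fin.val_rev] at h1 h2
    refine ⟨by omega, fun m hm => ?_⟩
    have := h2 m hm
    omega
  · exact absurd hlt (not_lt.2 (Delta_le_and_eq_iff_of_lex hq0 hqsum hqprod
      (fun m hm => (hbefore m hm).symm) hn).1)

theorem Delta_rev_eq (hq0 : ∀ i n, 0 < q i n) (hqsum : ∀ n, ∑ i : Fin s, q i n = 1)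
    (hqprod : Tendsto (fun N => ∏ n ∈ Finset.range N, ⨆ i : Fin s, q i n) atTop (𝓝 0))
    {α β : ℕ → Fin s} (heq : Delta s q α = Delta s q β) :
    Delta s q (fun n => (α n).rev) = Delta s q (fun n => (β n).rev) := by
  rcases lt_trichotomy (Delta s q fun n => (α n).rev) (Delta s q fun n => (β n).rev) with h | h | h
  · exact absurd heq (by simpa using (Delta_rev_lt hq0 hqsum hqprod h).ne')
  · exact h
  · exact absurd heq (by simpa using (Delta_rev_lt hq0 hqsum hqprod h).ne)

end QStar

/-- the digit inversor I(x) = Δ((s−1−α_n(x))) satisfies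
I(Δ(α)) = Δ((s−1−α_n)) for every digit sequence α, and I is continuous and
strictly decreasing on [0,1]. -/
theorem stmt11 (s : ℕ) (hs : 2 ≤ s) (q : Fin s → ℕ → ℝ)
    (hq0 : ∀ i n, 0 < q i n) (hq1 : ∀ i n, q i n < 1)
    (hqsum : ∀ n, ∑ i : Fin s, q i n = 1)
    (hqprod : Filter.Tendsto (fun N => ∏ n ∈ Finset.range N, ⨆ i : Fin s, q i n)
      Filter.atTop (nhds 0))
    (D : ℝ → ℕ → Fin s)
    (hD : ∀ x ∈ Set.Icc (0 : ℝ) 1, Delta s q (D x) = x)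
    (hDcanon : ∀ x ∈ Set.Icc (0 : ℝ) 1, x ≠ 1 → ¬ ∃ N, ∀ n ≥ N, ((D x n : ℕ) = s - 1))
    (hD1 : ∀ n, ((D 1 n : ℕ) = s - 1))
    (I : ℝ → ℝ)
    (hI : ∀ x, I x =
      Delta s q (fun n => (⟨s - 1 - (D x n).1, by have := (D x n).2; omega⟩ : Fin s))) :
    (∀ α : ℕ → Fin s,
        I (Delta s q α) =
          Delta s q (fun n => (⟨s - 1 - (α n).1, by have := (α n).2; omega⟩ : Fin s))) ∧
      ContinuousOn I (Set.Icc 0 1) ∧ StrictAntiOn I (Set.Icc 0 1) := by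
  have hrev : ∀ α : ℕ → Fin s,
      (fun n => (⟨s - 1 - (α n).1, by have := (α n).2; omega⟩ : Fin s)) = fun n => (α n).rev :=
    fun α => funext fun n => Fin.ext (by simp only [Fin.val_rev]; omega)
  simp only [hrev] at hI ⊢
  have hmem := QStar.Delta_mem_Icc hq0 hqsum hqprod
  have hID : ∀ α : ℕ → Fin s, I (Delta s q α) = Delta s q fun n => (α n).rev := fun α => by
    rw [hI]
    exact QStar.Delta_rev_eq hq0 hqsum hqprod (hD _ (hmem α))
  have hanti : StrictAntiOn I (Icc 0 1) := fun x hx y hy hxy => by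
    rw [hI, hI]
    refine QStar.Delta_rev_lt hq0 hqsum hqprod ?_
    rwa [hD x hx, hD y hy]
  refine ⟨hID, ?_, hanti⟩
  have hmaps : ∀ x, I x ∈ Icc (0 : ℝ) 1 := fun x => hI x ▸ hmem _
  let f : Icc (0 : ℝ) 1 → (Icc (0 : ℝ) 1)ᵒᵈ := fun x => OrderDual.toDual ⟨I x, hmaps x⟩
  have hmono : Monotone f := fun x y hxy => hanti.antitoneOn x.2 y.2 hxy
  have hsurj : Function.Surjective f := fun y => by
    let z : Icc (0 : ℝ) 1 := OrderDual.ofDual y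
    refine ⟨⟨_, hmem fun n => (D z n).rev⟩, congrArg OrderDual.toDual (Subtype.ext (a2 := z) ?_)⟩
    simp only [hID, Fin.rev_rev]
    exact hD z z.2
  rw [continuousOn_iff_continuous_domRestrict]
  exact continuous_subtype_val.comp
    (continuous_ofDual.comp (hmono.continuous_of_surjective hsurj))
end

section
/- The value set E_{f_a} = {Δ((|a_n − α_n|)_{n≥1}) : α any digit sequence} equals the Cantor-type set C[Q*_s; V] = {Δ(β) : β a digit sequence with β_n ∈ V_n for all n}, where V_n = {0, 1, …, max(s−1−a_n, a_n)} for each n ≥ 1. -/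
open Filter Topology MeasureTheory Set

set_option linter.unusedVariables false

theorem exists_adiff_eq {s : ℕ} (a b : Fin s) (h : b.1 ≤ max (s - 1 - a.1) a.1) :
    ∃ c : Fin s, adiff a c = b := by
  have ha := a.2
  have hb := b.2
  by_cases hba : b.1 ≤ a.1
  · refine ⟨⟨a.1 - b.1, by omega⟩, Fin.ext ?_⟩
    simp only [adiff]
    omega
  · refine ⟨⟨a.1 + b.1, by omega⟩, Fin.ext ?_⟩
    simp only [adiff]
    omega

theorem adiff_le_max {s : ℕ} (a c : Fin s) :
    (adiff a c).1 ≤ max (s - 1 - a.1) a.1 := by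
  have hc := c.2
  simp only [adiff]
  omega

/-- the value set E_{f_a} equals the Cantor-type set C[Q*_s; V] with
V_n = {0,…,max(s−1−a_n, a_n)}. -/
theorem stmt12 (s : ℕ) (hs : 2 ≤ s) (q : Fin s → ℕ → ℝ)
    (hq0 : ∀ i n, 0 < q i n) (hq1 : ∀ i n, q i n < 1)
    (hqsum : ∀ n, ∑ i : Fin s, q i n = 1)
    (hqprod : Filter.Tendsto (fun N => ∏ n ∈ Finset.range N, ⨆ i : Fin s, q i n)
      Filter.atTop (nhds 0))
    (a : ℝ) (ha : a ∈ Set.Icc (0 : ℝ) 1) (aseq : ℕ → Fin s)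
    (haseq : a = ∑' n : ℕ, (aseq n : ℝ) / (s : ℝ) ^ (n + 1)) :
    {y : ℝ | ∃ α : ℕ → Fin s, y = Delta s q (fun n => adiff (aseq n) (α n))} =
      {y : ℝ | ∃ β : ℕ → Fin s,
        (∀ n, (β n).1 ≤ max (s - 1 - (aseq n).1) (aseq n).1) ∧ y = Delta s q β} := by
  ext y
  constructor
  · rintro ⟨α, rfl⟩
    exact ⟨_, fun n => adiff_le_max (aseq n) (α n), rfl⟩
  · rintro ⟨β, hβ, rfl⟩
    choose α hα using fun n => exists_adiff_eq (aseq n) (β n) (hβ n)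
    exact ⟨α, by simp only [hα]⟩
end
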